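/- Let q : ℝ → ℂ be 1-periodic, integrable on [0,1], with Fourier coefficients q_n = ∫₀¹ q(x)e^{-2πinx}dx satisfying q_n = 0 for all integers n ≤ 0, let n ∈ ℤ, and let t ∈ ℂ with t ≠ πk for every integer k. If y is an eigenfunction of L_t(q) corresponding to the eigenvalue (2πn+t)², then ∫₀¹ y(x)e^{-i(2π(n+p)+t)x}dx = 0 for every integer p < 0, and ∫₀¹ y(x)e^{-i(2πn+t)x}dx ≠ 0. -/

import Mathlib

open MeasureTheory Filter

noncomputable section

/-- The `n`-th Fourier coefficient of `q` on `[0,1]`: `∫₀¹ q(x) e^{-2πinx} dx`. -/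
def fCoeff (q : ℝ → ℂ) (n : ℤ) : ℂ :=
  ∫ x in (0:ℝ)..1, q x * Complex.exp (-(2 * (Real.pi : ℂ) * Complex.I * (n : ℂ) * (x : ℂ)))

/-- `q` is 1-periodic, integrable on `[0,1]`, and all its Fourier coefficients with
nonpositive index vanish (the class `L¹₊`). -/
def MemL1Plus (q : ℝ → ℂ) : Prop :=
  (∀ x : ℝ, q (x + 1) = q x) ∧ IntervalIntegrable q volume 0 1 ∧
    ∀ n : ℤ, n ≤ 0 → fCoeff q n = 0

/-- `y` is a solution of `-y'' + q y = lam y` in the integral (Carathéodory) sense. -/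
def IsCaraSol (q : ℝ → ℂ) (lam : ℂ) (y : ℝ → ℂ) : Prop :=
  Differentiable ℝ y ∧
    ∀ x : ℝ, deriv y x = deriv y 0 + ∫ s in (0:ℝ)..x, (q s - lam) * y s

/-- `y` is an eigenfunction of `L_t(q)` with eigenvalue `lam`. -/
def IsEigenfun (q : ℝ → ℂ) (t lam : ℂ) (y : ℝ → ℂ) : Prop :=
  IsCaraSol q lam y ∧ (∃ x : ℝ, y x ≠ 0) ∧
    y 1 = Complex.exp (Complex.I * t) * y 0 ∧
    deriv y 1 = Complex.exp (Complex.I * t) * deriv y 0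

/-- Fubini's theorem on the triangle `s ≤ x`: integration by parts for a primitive of an
integrable function. -/
theorem integral_primitive_mul {f g g' : ℝ → ℂ} (hf : IntervalIntegrable f volume 0 1)
    (hg : ∀ x, HasDerivAt g (g' x) x) (hg' : Continuous g') :
    ∫ x in (0:ℝ)..1, (∫ s in (0:ℝ)..x, f s) * g' x = ∫ s in (0:ℝ)..1, f s * (g 1 - g s) := by
  have h1 : ∀ x ∈ Set.uIcc (0:ℝ) 1, (∫ s in (0:ℝ)..x, f s) * g' x =
      ∫ s in (0:ℝ)..1, {p : ℝ × ℝ | p.2 ≤ p.1}.indicator (fun p => f p.2 * g' p.1) (x, s) := by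
    intro x hx
    rw [Set.uIcc_of_le zero_le_one] at hx
    rw [← intervalIntegral.integral_mul_const, intervalIntegral.integral_of_le hx.1,
      intervalIntegral.integral_of_le zero_le_one]
    have : ∀ s, {p : ℝ × ℝ | p.2 ≤ p.1}.indicator (fun p => f p.2 * g' p.1) (x, s) =
        (Set.Iic x).indicator (fun s => f s * g' x) s := fun s => by
      simp [Set.indicator_apply]
    simp_rw [this]
    rw [setIntegral_indicator measurableSet_Iic, Set.Ioc_inter_Iic, min_eq_right hx.2]
  have h2 : ∀ s ∈ Set.uIcc (0:ℝ) 1, f s * (g 1 - g s) =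
      ∫ x in (0:ℝ)..1, {p : ℝ × ℝ | p.2 ≤ p.1}.indicator (fun p => f p.2 * g' p.1) (x, s) := by
    intro s hs
    rw [Set.uIcc_of_le zero_le_one] at hs
    rw [← intervalIntegral.integral_eq_sub_of_hasDerivAt (fun x _ => hg x)
      (hg'.intervalIntegrable _ _), ← intervalIntegral.integral_const_mul,
      intervalIntegral.integral_of_le hs.2, intervalIntegral.integral_of_le zero_le_one,
      ← integral_Icc_eq_integral_Ioc, ← integral_Icc_eq_integral_Ioc]
    have : ∀ x, {p : ℝ × ℝ | p.2 ≤ p.1}.indicator (fun p => f p.2 * g' p.1) (x, s) =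
        (Set.Ici s).indicator (fun x => f s * g' x) x := fun x => by
      simp [Set.indicator_apply]
    simp_rw [this]
    rw [setIntegral_indicator measurableSet_Ici,
      show Set.Icc 0 1 ∩ Set.Ici s = Set.Icc s 1 by ext; grind]
  rw [intervalIntegral.integral_congr h1, intervalIntegral.integral_congr h2]
  refine intervalIntegral_intervalIntegral_swap
    (F := fun x s => {p : ℝ × ℝ | p.2 ≤ p.1}.indicator (fun p => f p.2 * g' p.1) (x, s)) ?_
  have hm : MeasurableSet {p : ℝ × ℝ | p.2 ≤ p.1} := measurableSet_le measurable_snd measurable_fst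
  have hi := ((hg'.intervalIntegrable (μ := volume) 0 1).def'.mul_prod hf.def')
  simpa only [IntegrableOn, Measure.prod_restrict, mul_comm, Function.uncurry_def] using!
    hi.indicator hm

theorem IsCaraSol.intervalIntegrable_mul {q y : ℝ → ℂ} {lam : ℂ} (hy : IsCaraSol q lam y)
    {a b : ℝ} (hq : IntervalIntegrable q volume a b) :
    IntervalIntegrable (fun s => (q s - lam) * y s) volume a b :=
  (hq.sub intervalIntegrable_const).mul_continuousOn hy.1.continuous.continuousOn

/-- The equation `-y'' + q y = lam y` tested against `exp (-iαx)` for quasi-periodic `y`. -/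
theorem IsEigenfun.sub_sq_mul_integral {q y : ℝ → ℂ} {t lam α : ℂ} (hy : IsEigenfun q t lam y)
    (hq : IntervalIntegrable q volume 0 1) (hdc : Continuous (deriv y))
    (hα : Complex.exp (-(Complex.I * α)) = Complex.exp (-(Complex.I * t))) :
    (lam - α ^ 2) * ∫ x in (0:ℝ)..1, y x * Complex.exp (-(Complex.I * α * (x : ℂ))) =
      ∫ x in (0:ℝ)..1, q x * (y x * Complex.exp (-(Complex.I * α * (x : ℂ)))) := by
  obtain ⟨hs, -, h1, h2⟩ := hy
  set e : ℝ → ℂ := fun x => Complex.exp (-(Complex.I * α * (x : ℂ))) with he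
  have hed : ∀ x, HasDerivAt e (-(Complex.I * α) * e x) x := fun x => by
    have h : HasDerivAt (fun z : ℂ => Complex.exp (-(Complex.I * α * z)))
        (Complex.exp (-(Complex.I * α * x)) * (-(Complex.I * α * 1))) (x : ℂ) :=
      (((hasDerivAt_id (x : ℂ)).const_mul (Complex.I * α)).neg).cexp
    convert h.comp_ofReal using 1
    simp only [he]; ring
  have hec : Continuous e := by simp only [he]; fun_prop
  have hyc := hs.1.continuous
  have hE : Complex.exp (Complex.I * t) * e 1 = 1 := by
    simp only [he, Complex.ofReal_one, mul_one, hα, ← Complex.exp_add]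
    simp
  have he0 : e 0 = 1 := by simp [he]
  have hint := hs.intervalIntegrable_mul hq
  have hqy : IntervalIntegrable (fun x => q x * (y x * e x)) volume 0 1 :=
    hq.mul_continuousOn (hyc.mul hec).continuousOn
  have hye : IntervalIntegrable (fun x => y x * e x) volume 0 1 :=
    (hyc.mul hec).intervalIntegrable _ _
  have hprim := integral_primitive_mul hint hed (by fun_prop)
  have hF : ∀ x, ∫ s in (0:ℝ)..x, (q s - lam) * y s = deriv y x - deriv y 0 := fun x => by
    rw [hs.2 x]; ring
  have hparts := intervalIntegral.integral_deriv_mul_eq_sub (u := y) (v := e)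
    (a := 0) (b := 1) (fun x _ => hs.1.differentiableAt.hasDerivAt) (fun x _ => hed x)
    (hdc.intervalIntegrable _ _) ((by fun_prop : Continuous _).intervalIntegrable _ _)
  have hye' : IntervalIntegrable (fun x => deriv y x * e x) volume 0 1 :=
    (hdc.mul hec).intervalIntegrable _ _
  have e1 : ∫ x in (0:ℝ)..1, (∫ s in (0:ℝ)..x, (q s - lam) * y s) * (-(Complex.I * α) * e x) =
      -(Complex.I * α) * (∫ x in (0:ℝ)..1, deriv y x * e x) - deriv y 0 * (e 1 - e 0) := by
    simp_rw [hF]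
    rw [← intervalIntegral.integral_eq_sub_of_hasDerivAt (fun x _ => hed x)
      ((by fun_prop : Continuous _).intervalIntegrable _ _),
      ← intervalIntegral.integral_const_mul, ← intervalIntegral.integral_const_mul,
      ← intervalIntegral.integral_sub (hye'.const_mul _)
        ((by fun_prop : Continuous _).intervalIntegrable _ _)]
    congr 1; ext x; ring
  have e2 : ∫ s in (0:ℝ)..1, (q s - lam) * y s * (e 1 - e s) =
      (deriv y 1 - deriv y 0) * e 1 -
        ((∫ x in (0:ℝ)..1, q x * (y x * e x)) - lam * ∫ x in (0:ℝ)..1, y x * e x) := by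
    rw [← hF 1, ← intervalIntegral.integral_mul_const, ← intervalIntegral.integral_const_mul,
      ← intervalIntegral.integral_sub hqy (hye.const_mul _),
      ← intervalIntegral.integral_sub (hint.mul_const _) (hqy.sub (hye.const_mul _))]
    congr 1; ext x; ring
  have e3 : ∫ x in (0:ℝ)..1, (deriv y x * e x + y x * (-(Complex.I * α) * e x)) =
      (∫ x in (0:ℝ)..1, deriv y x * e x) - Complex.I * α * ∫ x in (0:ℝ)..1, y x * e x := by
    rw [← intervalIntegral.integral_const_mul,
      ← intervalIntegral.integral_sub hye' (hye.const_mul _)]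
    congr 1; ext x; ring
  rw [e1, e2, h2, he0] at hprim
  rw [e3, h1, he0] at hparts
  linear_combination (-1 : ℂ) * hprim - Complex.I * α * hparts +
    (-deriv y 0 - Complex.I * α * y 0) * hE - α ^ 2 * (∫ x in (0:ℝ)..1, y x * e x) * Complex.I_sq

/-- A summable sequence on `ℤ` in which every term but the `n`-th is controlled by the sum of the
preceding ones vanishes below `n`. -/
theorem eq_zero_of_norm_le_mul_tsum_Iio {a : ℤ → ℂ} {w : ℤ → ℝ} {n : ℤ} (hw : Summable w)
    (hw0 : ∀ k, 0 ≤ w k) (ha : Summable fun k => ‖a k‖)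
    (h : ∀ k, k ≠ n → ‖a k‖ ≤ w k * ∑' m, (Set.Iio k).indicator (fun m => ‖a m‖) m) :
    (∀ k < n, a k = 0) ∧ (a n = 0 → ∀ k, a k = 0) := by
  have hstep : ∀ k, k ≠ n → (∀ m < k, a m = 0) → a k = 0 := fun k hk hm => by
    have h0 : (Set.Iio k).indicator (fun m => ‖a m‖) = fun _ => 0 := by
      ext m
      by_cases hmk : m < k <;> simp [hmk, hm]
    have := h k hk
    rw [h0] at this
    simpa using this
  have hlim : Tendsto (fun K : ℤ => ∑' k, (Set.Iio K).indicator w k) atBot (nhds 0) := by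
    rw [← tsum_zero (β := ℤ)]
    refine tendsto_tsum_of_dominated_convergence hw (fun k => ?_) (Eventually.of_forall ?_)
    · refine tendsto_const_nhds.congr' ?_
      filter_upwards [eventually_le_atBot k] with K hK
      simp [hK]
    · intro K k
      by_cases hk : k < K <;> simp [hk, abs_of_nonneg, hw0]
  obtain ⟨K, hK, hKn⟩ := ((hlim.eventually (gt_mem_nhds one_half_pos)).and
    (eventually_le_atBot n)).exists
  set S := ∑' k, (Set.Iio K).indicator (fun m => ‖a m‖) k with hS
  have hS0 : 0 ≤ S := tsum_nonneg fun k => Set.indicator_nonneg (fun _ _ => norm_nonneg _) k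
  have hSle : S ≤ (∑' k, (Set.Iio K).indicator w k) * S := by
    rw [← tsum_mul_right]
    refine (ha.indicator _).tsum_le_tsum (fun k => ?_) ((hw.indicator _).mul_right S)
    by_cases hk : k < K
    · simp only [Set.indicator_of_mem (Set.mem_Iio.2 hk)]
      refine (h k (by lia)).trans (mul_le_mul_of_nonneg_left ?_ (hw0 k))
      refine (ha.indicator _).tsum_le_tsum (fun m => ?_) (ha.indicator _)
      exact Set.indicator_le_indicator_of_subset (Set.Iio_subset_Iio hk.le)
        (fun _ => norm_nonneg _) m
    · simp [hk]
  have hSz : S = 0 := by nlinarith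
  have hbase : ∀ k < K, a k = 0 := fun k hk => by
    have := (ha.indicator (Set.Iio K)).le_tsum k
      (fun m _ => Set.indicator_nonneg (fun _ _ => norm_nonneg _) m)
    rw [← hS, hSz, Set.indicator_of_mem (Set.mem_Iio.2 hk)] at this
    simpa using this
  have hbelow : ∀ k < n, a k = 0 := fun k => by
    induction k using Int.strongRec (m := K) with
    | lt k hk => exact fun _ => hbase k hk
    | ge k _ ih => exact fun hkn => hstep k hkn.ne fun m hm => ih m hm (hm.trans hkn)
  refine ⟨hbelow, fun hn k => ?_⟩
  induction k using Int.strongRec (m := n) with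
  | lt k hk => exact hbelow k hk
  | ge k _ ih =>
    by_cases hkn : k = n
    · rw [hkn, hn]
    · exact hstep k hkn ih

/-- A solution of `-y'' + q y = lam y` with zero Cauchy data at `0` vanishes identically. -/
theorem IsCaraSol.eq_zero {q y : ℝ → ℂ} {lam : ℂ} (hy : IsCaraSol q lam y)
    (hq : ∀ a b, IntervalIntegrable q volume a b) (hdc : Continuous (deriv y))
    (h0 : y 0 = 0) (h0' : deriv y 0 = 0) (x : ℝ) : y x = 0 := by
  have hyc := hy.1.continuous
  have hint := fun a b => hy.intervalIntegrable_mul (hq a b)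
  have hderiv : ∀ a x, deriv y x = deriv y a + ∫ s in a..x, (q s - lam) * y s := fun a x => by
    rw [hy.2 x, hy.2 a, add_assoc, intervalIntegral.integral_add_adjacent_intervals (hint _ _)
      (hint _ _)]
  set Z : Set ℝ := {x | y x = 0 ∧ deriv y x = 0} with hZ
  have hclosed : IsClosed Z :=
    (isClosed_eq hyc continuous_const).inter (isClosed_eq hdc continuous_const)
  have hopen : IsOpen Z := by
    rw [Metric.isOpen_iff]
    rintro a ⟨ha, ha'⟩
    set C := ∫ s in (a - 1)..(a + 1), ‖q s - lam‖ with hC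
    have hgi : ∀ b c, IntervalIntegrable (fun s => ‖q s - lam‖) volume b c := fun b c =>
      ((hq b c).sub intervalIntegrable_const).norm
    have hC0 : 0 ≤ C := intervalIntegral.integral_nonneg (by linarith) fun _ _ => norm_nonneg _
    set δ := 1 / (2 * (C + 1)) with hδ
    have hδ0 : 0 < δ := by positivity
    have hδC : δ * (C + 1) = 1 / 2 := by rw [hδ]; field_simp
    have hδ1 : δ ≤ 1 := by nlinarith
    have hne : (Set.Icc (a - δ) (a + δ)).Nonempty := ⟨a, by constructor <;> linarith⟩
    obtain ⟨x₀, hx₀, hmax⟩ := isCompact_Icc.exists_isMaxOn hne hyc.norm.continuousOn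
    set M := ‖y x₀‖ with hM
    have hsub : ∀ x ∈ Set.Icc (a - δ) (a + δ), Set.uIcc a x ⊆ Set.Icc (a - δ) (a + δ) :=
      fun x hx => Set.uIcc_subset_Icc ⟨by linarith, by linarith⟩ hx
    have hbd : ∀ x ∈ Set.Icc (a - δ) (a + δ), ‖deriv y x‖ ≤ C * M := fun x hx => by
      rw [hderiv a x, ha', zero_add]
      calc ‖∫ s in a..x, (q s - lam) * y s‖
          ≤ ∫ s in Set.uIoc a x, ‖(q s - lam) * y s‖ :=
            intervalIntegral.norm_integral_le_integral_norm_uIoc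
        _ ≤ ∫ s in Set.uIoc a x, ‖q s - lam‖ * M := by
            refine setIntegral_mono_on (hint a x).norm.def' ((hgi a x).mul_const M).def'
              measurableSet_uIoc fun s hs => ?_
            rw [norm_mul]
            exact mul_le_mul_of_nonneg_left (hmax (hsub x hx (Set.uIoc_subset_uIcc hs)))
              (norm_nonneg _)
        _ = (∫ s in Set.uIoc a x, ‖q s - lam‖) * M := integral_mul_const _ _
        _ ≤ C * M := by
            refine mul_le_mul_of_nonneg_right ?_ (norm_nonneg _)
            rw [hC, intervalIntegral.integral_of_le (by linarith)]
            refine setIntegral_mono_set ?_ (ae_of_all _ fun _ => norm_nonneg _) ?_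
            · have := (hgi (a - 1) (a + 1)).def'
              rwa [Set.uIoc_of_le (by linarith)] at this
            · refine LE.le.eventuallyLE (Set.Ioc_subset_Ioc ?_ ?_)
              · exact le_min (by linarith) (by linarith [hx.1])
              · exact max_le (by linarith) (by linarith [hx.2])
    have hMle : M ≤ C * M * δ := by
      have := (convex_Icc (a - δ) (a + δ)).norm_image_sub_le_of_norm_deriv_le
        (fun x _ => hy.1.differentiableAt) hbd (x := a) (y := x₀)
        ⟨by linarith, by linarith⟩ hx₀
      rw [ha, sub_zero] at this
      refine this.trans (mul_le_mul_of_nonneg_left ?_ (by positivity))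
      rw [Real.norm_eq_abs, abs_le]
      constructor <;> linarith [hx₀.1, hx₀.2]
    have hM0 : 0 ≤ M := norm_nonneg _
    have hMz : M = 0 := by nlinarith
    refine ⟨δ, hδ0, fun x hx => ?_⟩
    have hx' : x ∈ Set.Icc (a - δ) (a + δ) := by
      rw [Real.ball_eq_Ioo] at hx
      exact Set.Ioo_subset_Icc_self hx
    have h1 := hmax hx'
    have h2 := hbd x hx'
    rw [hMz, mul_zero] at h2
    exact ⟨norm_le_zero_iff.1 (hMz ▸ h1), norm_le_zero_iff.1 h2⟩
  have huniv : Z = Set.univ := IsClopen.eq_univ ⟨hclosed, hopen⟩ ⟨0, h0, h0'⟩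
  exact (huniv ▸ Set.mem_univ x : x ∈ Z).1

/-- A continuous function on `[0,1]` with equal end values and summable Fourier coefficients is
the pointwise sum of its Fourier series. -/
theorem hasSum_fCoeff_mul_exp {z : ℝ → ℂ} (hz : Continuous z) (h01 : z 0 = z 1)
    (hs : Summable (fCoeff z)) {x : ℝ} (hx : x ∈ Set.Ico (0:ℝ) 1) :
    HasSum (fun k : ℤ => fCoeff z k * Complex.exp (2 * (Real.pi : ℂ) * Complex.I * k * x))
      (z x) := by
  have hT : Fact ((0:ℝ) < 1) := ⟨one_pos⟩
  let Z : C(AddCircle (1:ℝ), ℂ) :=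
    ⟨AddCircle.liftIco 1 0 z, AddCircle.liftIco_zero_continuous h01 hz.continuousOn⟩
  have hc : fourierCoeff Z = fCoeff z := by
    ext k
    change fourierCoeff (AddCircle.liftIco 1 0 z) k = _
    rw [fourierCoeff_liftIco_eq, fourierCoeffOn_eq_integral]
    simp only [zero_add, sub_zero, div_one, one_smul, fCoeff, smul_eq_mul]
    refine intervalIntegral.integral_congr fun s _ => ?_
    simp only [fourier_coe_apply]
    rw [mul_comm]
    congr 2
    push_cast
    ring
  have h := has_pointwise_sum_fourier_series_of_summable (f := Z) (hc ▸ hs) (x : AddCircle (1:ℝ))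
  have hx' : Z (x : AddCircle (1:ℝ)) = z x := AddCircle.liftIco_zero_coe_apply hx
  rw [hx', hc] at h
  convert! h using 2 with k
  rw [fourier_coe_apply, smul_eq_mul]
  congr 2
  push_cast
  ring

theorem norm_exp_two_pi_I_mul (k : ℤ) (x : ℝ) :
    ‖Complex.exp (2 * (Real.pi : ℂ) * Complex.I * k * x)‖ = 1 := by
  rw [show (2 * (Real.pi : ℂ) * Complex.I * k * x) = ((2 * Real.pi * k * x : ℝ) : ℂ) * Complex.I by
    push_cast; ring, Complex.norm_exp_ofReal_mul_I]

theorem norm_fCoeff_le (f : ℝ → ℂ) (k : ℤ) : ‖fCoeff f k‖ ≤ ∫ x in (0:ℝ)..1, ‖f x‖ := by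
  refine (intervalIntegral.norm_integral_le_integral_norm zero_le_one).trans_eq ?_
  refine intervalIntegral.integral_congr fun x _ => ?_
  have := norm_exp_two_pi_I_mul (-k) x
  simp only [norm_mul]
  rw [show -(2 * (Real.pi : ℂ) * Complex.I * k * x) =
    2 * (Real.pi : ℂ) * Complex.I * ((-k : ℤ) : ℂ) * x by push_cast; ring, this, mul_one]

/-- The Fourier coefficients of a product are the convolution of the Fourier coefficients. -/
theorem hasSum_fCoeff_mul {q z : ℝ → ℂ} (hq : IntervalIntegrable q volume 0 1)
    (hz : Continuous z) (h01 : z 0 = z 1) (hs : Summable (fCoeff z)) (k : ℤ) :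
    HasSum (fun m : ℤ => fCoeff z m * fCoeff q (k - m)) (fCoeff (fun x => q x * z x) k) := by
  have hterm : ∀ m : ℤ, fCoeff z m * fCoeff q (k - m) =
      ∫ x in (0:ℝ)..1, fCoeff z m * Complex.exp (2 * (Real.pi : ℂ) * Complex.I * m * x) *
        (q x * Complex.exp (-(2 * (Real.pi : ℂ) * Complex.I * k * x))) := fun m => by
    rw [fCoeff.eq_def q, ← intervalIntegral.integral_const_mul]
    refine intervalIntegral.integral_congr fun x _ => ?_
    rw [show -(2 * (Real.pi : ℂ) * Complex.I * ((k - m : ℤ) : ℂ) * x) =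
      2 * (Real.pi : ℂ) * Complex.I * m * x + -(2 * (Real.pi : ℂ) * Complex.I * k * x) by
        push_cast; ring, Complex.exp_add]
    ring
  simp_rw [hterm]
  have hnorm : ∀ x : ℝ, ‖q x * Complex.exp (-(2 * (Real.pi : ℂ) * Complex.I * k * x))‖ = ‖q x‖ :=
    fun x => by
      rw [norm_mul, show -(2 * (Real.pi : ℂ) * Complex.I * k * x) =
        2 * (Real.pi : ℂ) * Complex.I * ((-k : ℤ) : ℂ) * x by push_cast; ring,
        norm_exp_two_pi_I_mul, mul_one]
  refine intervalIntegral.hasSum_integral_of_dominated_convergence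
    (fun m x => ‖fCoeff z m‖ * ‖q x‖) (fun m => ?_) (fun m => ae_of_all _ fun x _ => ?_)
    (ae_of_all _ fun x _ => hs.norm.mul_right _) ?_ ?_
  · refine (Continuous.aestronglyMeasurable (by fun_prop)).mul ?_
    exact hq.def'.aestronglyMeasurable.mul (Continuous.aestronglyMeasurable (by fun_prop))
  · rw [norm_mul, hnorm, norm_mul, norm_exp_two_pi_I_mul, mul_one]
  · simp_rw [tsum_mul_right]
    exact hq.norm.const_mul _
  · filter_upwards [compl_mem_ae_iff.2 (measure_singleton (1:ℝ))] with x hx1 hx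
    rw [Set.uIoc_of_le zero_le_one] at hx
    have := (hasSum_fCoeff_mul_exp hz h01 hs
      ⟨hx.1.le, lt_of_le_of_ne hx.2 hx1⟩).mul_right
        (q x * Complex.exp (-(2 * (Real.pi : ℂ) * Complex.I * k * x)))
    convert! this using 1
    ring

theorem summable_norm_inv_sq_sub_sq (n : ℤ) (t : ℂ) :
    Summable fun k : ℤ =>
      ‖((2 * (Real.pi : ℂ) * n + t) ^ 2 - (2 * (Real.pi : ℂ) * k + t) ^ 2)⁻¹‖ := by
  have hpi : (Real.pi : ℂ) ≠ 0 := Complex.ofReal_ne_zero.2 Real.pi_ne_zero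
  have h := ((EisensteinSeries.summable_linear_sub_mul_linear_add (2 * n + t / Real.pi) 0 1).mul_left
    ((4 * (Real.pi : ℂ) ^ 2)⁻¹))
  rw [← (Equiv.addRight n).summable_iff]
  refine h.norm.congr fun k => ?_
  rw [← mul_inv]
  simp only [Function.comp_apply, Equiv.coe_addRight]
  congr 2
  push_cast
  field_simp
  ring

theorem MemL1Plus.intervalIntegrable {q : ℝ → ℂ} (hq : MemL1Plus q) (a b : ℝ) :
    IntervalIntegrable q volume a b :=
  Function.Periodic.intervalIntegrable₀ hq.1 one_ne_zero hq.2.1 a b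

theorem IsCaraSol.continuous_deriv {q y : ℝ → ℂ} {lam : ℂ} (hy : IsCaraSol q lam y)
    (hq : ∀ a b, IntervalIntegrable q volume a b) : Continuous (deriv y) := by
  rw [funext hy.2]
  exact continuous_const.add
    (intervalIntegral.continuous_primitive (fun a b => hy.intervalIntegrable_mul (hq a b)) 0)

/-- Removing the Floquet factor turns the twisted integrals into Fourier coefficients. -/
theorem integral_mul_exp_eq_fCoeff (f : ℝ → ℂ) (t : ℂ) (k : ℤ) :
    ∫ x in (0:ℝ)..1,
        f x * Complex.exp (-(Complex.I * (2 * (Real.pi : ℂ) * (k : ℂ) + t) * (x : ℂ))) =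
      fCoeff (fun x => f x * Complex.exp (-(Complex.I * t * (x : ℂ)))) k := by
  refine intervalIntegral.integral_congr fun x _ => ?_
  simp only
  rw [mul_assoc (f x), ← Complex.exp_add]
  congr 2
  ring

/-- The Fourier coefficients of `y(x) e^{-itx}` vanish below the index `n`, and the `n`-th one
does not vanish. -/
theorem IsEigenfun.fCoeff_eq_zero_and_ne_zero {q : ℝ → ℂ} (hq : MemL1Plus q) {n : ℤ} {t : ℂ}
    (ht : ∀ k : ℤ, t ≠ (Real.pi : ℂ) * (k : ℂ)) {y : ℝ → ℂ}
    (hy : IsEigenfun q t ((2 * (Real.pi : ℂ) * (n : ℂ) + t) ^ 2) y) :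
    (∀ k < n, fCoeff (fun x => y x * Complex.exp (-(Complex.I * t * (x : ℂ)))) k = 0) ∧
      fCoeff (fun x => y x * Complex.exp (-(Complex.I * t * (x : ℂ)))) n ≠ 0 := by
  have hyc := hy.1.1.continuous
  have hdc := hy.1.continuous_deriv hq.intervalIntegrable
  set z : ℝ → ℂ := fun x => y x * Complex.exp (-(Complex.I * t * (x : ℂ))) with hz
  have hzc : Continuous z := by simp only [hz]; fun_prop
  have h01 : z 0 = z 1 := by
    simp only [hz, hy.2.2.1, Complex.ofReal_zero, Complex.ofReal_one, mul_one, mul_zero, neg_zero,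
      Complex.exp_zero]
    rw [mul_right_comm, ← Complex.exp_add, add_neg_cancel, Complex.exp_zero, one_mul]
  set D : ℤ → ℂ := fun k => (2 * (Real.pi : ℂ) * n + t) ^ 2 - (2 * (Real.pi : ℂ) * k + t) ^ 2
    with hD
  have hrel : ∀ k, D k * fCoeff z k = fCoeff (fun x => q x * z x) k := fun k => by
    have h := hy.sub_sq_mul_integral hq.2.1 hdc (α := 2 * (Real.pi : ℂ) * k + t) (by
      rw [show -(Complex.I * (2 * (Real.pi : ℂ) * k + t)) =
        -(Complex.I * t) + ((-k : ℤ) : ℂ) * (2 * Real.pi * Complex.I) by push_cast; ring,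
        Complex.exp_add, Complex.exp_int_mul_two_pi_mul_I, mul_one])
    simp_rw [← mul_assoc (q _)] at h
    rw [integral_mul_exp_eq_fCoeff, integral_mul_exp_eq_fCoeff] at h
    simpa only [hz, hD, mul_assoc] using h
  have hD0 : ∀ k, k ≠ n → D k ≠ 0 := fun k hk => by
    have hpi : (Real.pi : ℂ) ≠ 0 := Complex.ofReal_ne_zero.2 Real.pi_ne_zero
    have hf : D k = 2 * Real.pi * ((n - k : ℤ) : ℂ) * (2 * (t - Real.pi * ((-(n + k) : ℤ) : ℂ))) := by
      simp only [hD]; push_cast; ring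
    rw [hf]
    exact mul_ne_zero (mul_ne_zero (mul_ne_zero two_ne_zero hpi)
      (Int.cast_ne_zero.2 (sub_ne_zero.2 hk.symm))) (mul_ne_zero two_ne_zero (sub_ne_zero.2 (ht _)))
  have hdiv : ∀ k, k ≠ n → ‖fCoeff z k‖ = ‖(D k)⁻¹‖ * ‖fCoeff (fun x => q x * z x) k‖ :=
    fun k hk => by rw [← norm_mul, ← hrel, inv_mul_cancel_left₀ (hD0 k hk)]
  have hw := summable_norm_inv_sq_sub_sq n t
  have hs : Summable fun k => ‖fCoeff z k‖ := by
    refine (hw.mul_right (∫ x in (0:ℝ)..1, ‖q x * z x‖)).of_norm_bounded_eventually ?_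
    rw [Filter.eventually_cofinite]
    refine (Set.finite_singleton n).subset fun k hk => ?_
    by_contra hkn
    refine hk ?_
    rw [norm_norm, hdiv k hkn]
    exact mul_le_mul_of_nonneg_left (norm_fCoeff_le _ k) (norm_nonneg _)
  set B := ∫ x in (0:ℝ)..1, ‖q x‖ with hB
  have hB0 : 0 ≤ B := intervalIntegral.integral_nonneg zero_le_one fun _ _ => norm_nonneg _
  have hle : ∀ k, ‖fCoeff (fun x => q x * z x) k‖ ≤
      B * ∑' m, (Set.Iio k).indicator (fun m => ‖fCoeff z m‖) m := fun k => by
    rw [← (hasSum_fCoeff_mul hq.2.1 hzc h01 hs.of_norm k).tsum_eq, ← tsum_mul_left]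
    refine tsum_of_norm_bounded ((hs.indicator (Set.Iio k)).mul_left B).hasSum fun m => ?_
    by_cases hm : m < k
    · rw [Set.indicator_of_mem (Set.mem_Iio.2 hm), norm_mul, mul_comm]
      exact mul_le_mul_of_nonneg_right (norm_fCoeff_le q _) (norm_nonneg _)
    · simp [hm, hq.2.2 (k - m) (by lia)]
  obtain ⟨h1, h2⟩ := eq_zero_of_norm_le_mul_tsum_Iio (a := fCoeff z) (hw.mul_right B)
    (fun k => mul_nonneg (norm_nonneg _) hB0) hs (n := n) fun k hk => by
      rw [hdiv k hk, mul_assoc]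
      exact mul_le_mul_of_nonneg_left (hle k) (norm_nonneg _)
  refine ⟨h1, fun hn => ?_⟩
  have hall := h2 hn
  have hy0 : ∀ x ∈ Set.Ico (0:ℝ) 1, y x = 0 := fun x hx => by
    have h := hasSum_fCoeff_mul_exp hzc h01 hs.of_norm hx
    simp only [hall, zero_mul] at h
    exact (mul_eq_zero.1 (h.unique hasSum_zero)).resolve_right (Complex.exp_ne_zero _)
  have hd0 : deriv y 0 = 0 := by
    have hev : y =ᶠ[nhdsWithin 0 (Set.Ici 0)] fun _ => 0 := by
      filter_upwards [Ico_mem_nhdsGE (one_pos (α := ℝ))] with x hx using hy0 x hx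
    have h := (hasDerivWithinAt_const (0:ℝ) (Set.Ici 0) (0:ℂ)).congr_of_eventuallyEq hev
      (hy0 0 ⟨le_rfl, one_pos⟩)
    exact (uniqueDiffWithinAt_Ici (0:ℝ)).eq_deriv _
      hy.1.1.differentiableAt.hasDerivAt.hasDerivWithinAt h
  obtain ⟨x, hx⟩ := hy.2.1
  exact hx (hy.1.eq_zero hq.intervalIntegrable hdc (hy0 0 ⟨le_rfl, one_pos⟩) hd0 x)

/-- For `q ∈ L¹₊` and `t ≠ πk`, an eigenfunction of `L_t(q)` for the eigenvalue
`(2πn+t)²` satisfies `∫₀¹ y(x)e^{-i(2π(n+p)+t)x} dx = 0` for all `p < 0`, while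
`∫₀¹ y(x)e^{-i(2πn+t)x} dx ≠ 0`. -/
theorem eigenfunction_coeffs (q : ℝ → ℂ) (hq : MemL1Plus q) (n : ℤ) (t : ℂ)
    (ht : ∀ k : ℤ, t ≠ (Real.pi : ℂ) * (k : ℂ)) (y : ℝ → ℂ)
    (hy : IsEigenfun q t ((2 * (Real.pi : ℂ) * (n : ℂ) + t) ^ 2) y) :
    (∀ p : ℤ, p < 0 →
      (∫ x in (0:ℝ)..1, y x *
        Complex.exp (-(Complex.I * (2 * (Real.pi : ℂ) * ((n + p : ℤ) : ℂ) + t) * (x : ℂ)))) = 0) ∧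
    (∫ x in (0:ℝ)..1, y x *
      Complex.exp (-(Complex.I * (2 * (Real.pi : ℂ) * (n : ℂ) + t) * (x : ℂ)))) ≠ 0 := by
  simp only [integral_mul_exp_eq_fCoeff]
  obtain ⟨h1, h2⟩ := IsEigenfun.fCoeff_eq_zero_and_ne_zero hq ht hy
  exact ⟨fun p hp => h1 (n + p) (by lia), h2⟩

end
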